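/- There exists a binary self-dual code 𝒞 ⊆ 𝔽₂^{82} of dimension 41 and minimum Hamming distance 14 whose weight enumerator satisfies A₁₄ = 3280 + 2α, A₁₆ = 36244 − 2α + 128β and A₁₈ = 506153 − 26α − 896β with α = −738 and β = 18. -/

import Mathlib

/-- The Hamming weight of a binary vector. -/
def wt {m : ℕ} (x : Fin m → ZMod 2) : ℕ :=
  (Finset.univ.filter fun i => x i ≠ 0).card

/-- The rows of the right half of the generator matrix, as binary numbers. -/
def rowBits : List ℕ :=
  [235192289583, 622406074329, 210461535140, 1899188560216, 109014737802, 395103580710,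
    674463642263, 1130308547538, 310715526742, 1471509041093, 720662623199, 649816915383,
    2001347380939, 2159440355477, 777501821318, 779636105116, 250631829296, 1275559413312,
    626351547692, 1833494774544, 1491057106882, 1329923000691, 1463201716079, 1124182984566,
    458718726602, 1298967334965, 1575457370395, 1639396551908, 2198317861020, 906190752962,
    818969014843, 1290811721296, 1850899990278, 2190583058730, 1901184566994, 1373726262204,
    1421531834541, 962731204862, 755738691127, 877027738808, 970345623788]

/-- The columns of the right half of the generator matrix, as binary numbers. -/
def colBits : List ℕ :=
  [344778096195, 444091882993, 1619651784549, 1899806102555, 1017213726154, 2174509975589,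
    1256981665674, 1907922894550, 47345159839, 333948098550, 848941259522, 69678975751,
    1109281311970, 1306945465854, 1094164997202, 15941547419, 1962339735689, 1223208832994,
    686053828365, 1958007601239, 1141763300620, 683874246860, 819585844766, 902446053009,
    1598691905744, 712033518755, 1530919832096, 1214969495522, 933056942888, 2153573388474,
    1482687462707, 1503203866147, 1409163779316, 410020032169, 875617644225, 961520796024,
    62150539903, 1579997193229, 1865044472608, 2093528972362, 135811183240]

section PackBits

variable {α β : Type*}

/-- The natural number whose binary digits are the values of `f` along the list `l`. -/
def packBits (l : List α) (f : α → Bool) : ℕ :=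
  l.foldr (fun a n => Nat.bit (f a) n) 0

@[simp] lemma packBits_nil (f : α → Bool) : packBits [] f = 0 := rfl

lemma packBits_cons (a : α) (l : List α) (f : α → Bool) :
    packBits (a :: l) f = Nat.bit (f a) (packBits l f) := rfl

lemma packBits_xor (l : List α) (f g : α → Bool) :
    packBits l f ^^^ packBits l g = packBits l fun a => (f a ^^ g a) := by
  induction l with
  | nil => simp
  | cons a l ih => simp [packBits_cons, Nat.xor_bit, ih]

lemma packBits_and (l : List α) (f g : α → Bool) :
    packBits l f &&& packBits l g = packBits l fun a => (f a && g a) := by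
  induction l with
  | nil => simp
  | cons a l ih => simp [packBits_cons, Nat.land_bit, ih]

@[simp] lemma packBits_false (l : List α) : packBits l (fun _ => false) = 0 := by
  induction l with
  | nil => rfl
  | cons a l ih => simp [packBits_cons, ih]

lemma packBits_cond (l : List α) (b : Bool) :
    (bif b then packBits l (fun _ => true) else 0) = packBits l fun _ => b := by
  cases b <;> simp

lemma packBits_append (l l' : List α) (f : α → Bool) :
    packBits (l ++ l') f = packBits l f + packBits l' f <<< l.length := by
  induction l with
  | nil => simp
  | cons a l ih =>
    simp only [List.cons_append, packBits_cons, ih, Nat.bit_val, List.length_cons,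
      Nat.shiftLeft_eq, pow_succ]
    ring

lemma packBits_map (l : List β) (g : β → α) (f : α → Bool) :
    packBits (l.map g) f = packBits l fun b => f (g b) := by
  induction l with
  | nil => rfl
  | cons a l ih => simp [packBits_cons, ih]

lemma packBits_eq_zero_iff (l : List α) (f : α → Bool) :
    packBits l f = 0 ↔ l.countP f = 0 := by
  induction l with
  | nil => simp
  | cons a l ih => cases h : f a <;> simp_all [packBits_cons, Nat.bit_val]

/-- Number of binary digits `1` of a natural number, found by clearing the lowest such digit
repeatedly; the first argument bounds the number of steps. -/
def popCount : ℕ → ℕ → ℕ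
  | 0, _ => 0
  | f + 1, n => bif n.beq 0 then 0 else popCount f (n &&& (n - 1)) + 1

lemma exists_packBits_clear (l : List α) (f : α → Bool) (h : packBits l f ≠ 0) :
    ∃ g : List Bool, packBits l f &&& (packBits l f - 1) = packBits g id ∧
      g.countP id + 1 = l.countP f := by
  induction l with
  | nil => simp at h
  | cons a l ih =>
    cases ha : f a
    · have h' : packBits l f ≠ 0 := by
        simpa [packBits_cons, ha, Nat.bit_val] using h
      obtain ⟨g, hg, hc⟩ := ih h'
      refine ⟨false :: g, ?_, by simpa [ha] using hc⟩
      have : Nat.bit false (packBits l f) - 1 = Nat.bit true (packBits l f - 1) := by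
        simp only [Nat.bit_val, Bool.toNat_false, Bool.toNat_true]; omega
      simp only [packBits_cons, ha, this, Nat.land_bit, hg, Bool.false_and, id]
    · refine ⟨false :: l.map f, ?_, by simp [ha, List.countP_map]⟩
      have : Nat.bit true (packBits l f) - 1 = Nat.bit false (packBits l f) := by
        simp [Nat.bit_val]
      rw [packBits_cons, packBits_cons, ha, this, Nat.land_bit, Nat.and_self, packBits_map]
      rfl

lemma popCount_packBits {α : Type} (F : ℕ) (l : List α) (f : α → Bool) (hF : l.countP f ≤ F) :
    popCount F (packBits l f) = l.countP f := by
  induction F generalizing α with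
  | zero => simp only [popCount]; omega
  | succ F ih =>
    by_cases h : packBits l f = 0
    · simp [popCount, h, (packBits_eq_zero_iff l f).1 h]
    · obtain ⟨g, hg, hc⟩ := exists_packBits_clear l f h
      have hb : (packBits l f).beq 0 = false := by
        rw [← Bool.not_eq_true, Nat.beq_eq]; exact h
      rw [popCount, hb, cond_false, hg, ih g id (by omega), hc]

end PackBits

section Planes

/-- Bit-sliced storage of a list of binary vectors: the length of the list, the mask of that
length, and for each coordinate the bits of all vectors at this coordinate. -/
structure PlaneBlock where
  len : ℕ
  ones : ℕ
  planes : List ℕ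

/-- Concatenation of bit planes, the second family being translated by a vector. -/
def mergePlanes (len ones : ℕ) : List Bool → List ℕ → List ℕ → List ℕ
  | r :: rs, p :: ps, q :: qs =>
    (p + (q ^^^ (bif r then ones else 0)) <<< len) :: mergePlanes len ones rs ps qs
  | _, _, _ => []

/-- The block of `l ++ m.map (· + row)`, from the blocks of `l` and `m`. -/
def PlaneBlock.merge (row : List Bool) (b d : PlaneBlock) : PlaneBlock :=
  ⟨b.len + d.len, b.ones + d.ones <<< b.len, mergePlanes b.len d.ones row b.planes d.planes⟩

/-- Merges every block of a list with its predecessor. -/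
def mergeAll (row : List Bool) : PlaneBlock → List PlaneBlock → List PlaneBlock
  | _, [] => []
  | d, b :: bs => b.merge row d :: mergeAll row b bs

/-- Adds a one-bit plane to a family of bit-sliced binary counters (lowest digit first). -/
def addPlane : List ℕ → ℕ → List ℕ
  | [], _ => []
  | c :: cs, b => (c ^^^ b) :: addPlane cs (c &&& b)

/-- Bit-sliced counters with `f` digits and constant value `m`. -/
def constPlanes (ones : ℕ) : ℕ → ℕ → List ℕ
  | 0, _ => []
  | f + 1, m => (bif m.testBit 0 then ones else 0) :: constPlanes ones f (m / 2)

/-- Adds all bit planes, translated by a vector, to a family of bit-sliced counters. -/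
def addAll (ones : ℕ) : List Bool → List ℕ → List ℕ → List ℕ
  | o :: os, p :: ps, cs => addAll ones os ps (addPlane cs (p ^^^ (bif o then ones else 0)))
  | _, _, cs => cs

/-- The number of vectors of the block whose translate by `o` has weight at most `t`. -/
def PlaneBlock.countLE (o : List Bool) (b : PlaneBlock) (t : ℕ) : ℕ :=
  popCount b.len (b.ones ^^^ (addAll b.ones o b.planes (constPlanes b.ones 7 (63 - t))).getD 6 0)

/-- The total of the counts of vectors over all blocks, the weight bound decreasing by one from
each block to the next. -/
def countBlocks (o : List Bool) : List PlaneBlock → ℕ → ℕ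
  | [], _ => 0
  | b :: bs, t => b.countLE o t + countBlocks o bs (t - 1)

/-- The given number of lowest binary digits of a natural number, lowest digit first. -/
def bitList : ℕ → ℕ → List Bool
  | 0, _ => []
  | f + 1, m => m.testBit 0 :: bitList f (m / 2)

/-- Adds the rows one after the other to the sets under enumeration, counting the sums of low
weight that involve the new row. -/
def countRows (o t : ℕ) (b₀ : PlaneBlock) : List ℕ → List PlaneBlock → ℕ
  | [], _ => 0
  | r :: rs, bs =>
    countBlocks (bitList 41 (o ^^^ r)) (b₀ :: bs) t +
      countRows o t b₀ rs (mergeAll (bitList 41 r) b₀ bs)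

/-- The number of nonempty sets of at most `k` of the `rows` (binary vectors of length 41) such
that the size of the set plus the weight of its sum translated by `o` is at most `t`. -/
def countLow (rows : List ℕ) (o k t : ℕ) : ℕ :=
  countRows o (t - 1) ⟨1, 1, List.replicate 41 0⟩ rows
    (List.replicate (k - 1) ⟨0, 0, List.replicate 41 0⟩)

variable {m : ℕ}

/-- The binary vector of length `m` given by the binary digits of `n`. -/
def bitVec (m n : ℕ) : Fin m → ZMod 2 := fun j => if n.testBit j then 1 else 0

lemma bitVec_xor (a b : ℕ) : bitVec m (a ^^^ b) = bitVec m a + bitVec m b := by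
  ext j
  simp only [bitVec, Nat.testBit_xor, Pi.add_apply]
  cases a.testBit j <;> cases b.testBit j <;> decide

lemma bitList_eq (m n : ℕ) :
    bitList m n = (List.finRange m).map fun j => decide (bitVec m n j ≠ 0) := by
  have h : (fun j : Fin m => decide (bitVec m n j ≠ 0)) = fun j : Fin m => n.testBit j := by
    ext j; simp [bitVec]
  rw [h]
  clear h
  induction m generalizing n with
  | zero => rfl
  | succ m ih =>
    simp [bitList, ih, List.finRange_succ, Function.comp_def, Nat.testBit_succ]

/-- The block storing the list `l`. -/
def blockOf (l : List (Fin m → ZMod 2)) : PlaneBlock :=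
  ⟨l.length, packBits l fun _ => true,
    (List.finRange m).map fun j => packBits l fun v => decide (v j ≠ 0)⟩

lemma decide_add_ne_zero (a b : ZMod 2) :
    decide (a + b ≠ 0) = (decide (a ≠ 0) ^^ decide (b ≠ 0)) := by
  revert a b; decide

lemma merge_blockOf (l l' : List (Fin m → ZMod 2)) (r : ℕ) :
    (blockOf l).merge (bitList m r) (blockOf l') = blockOf (l ++ l'.map (· + bitVec m r)) := by
  have h : ∀ c : List (Fin m),
      mergePlanes l.length (packBits l' fun _ => true)
        (c.map fun j => decide (bitVec m r j ≠ 0))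
        (c.map fun j => packBits l fun v => decide (v j ≠ 0))
        (c.map fun j => packBits l' fun v => decide (v j ≠ 0)) =
      c.map fun j => packBits (l ++ l'.map (· + bitVec m r)) fun v => decide (v j ≠ 0) := by
    intro c
    induction c with
    | nil => rfl
    | cons j c ih =>
      simp only [List.map_cons, mergePlanes, ih, packBits_cond, packBits_xor, packBits_append,
        packBits_map, Pi.add_apply, decide_add_ne_zero]
  simp only [PlaneBlock.merge, blockOf, bitList_eq, h, packBits_append, packBits_map,
    List.length_append, List.length_map]

/-- `cs` is the family of the lowest digits of the values of `v` along `l`. -/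
def IsCounter {α : Type*} (l : List α) : List ℕ → (α → ℕ) → Prop
  | [], _ => True
  | c :: cs, v => c = packBits l (fun a => (v a).testBit 0) ∧ IsCounter l cs fun a => v a / 2

lemma IsCounter.addPlane {α : Type*} {l : List α} {cs : List ℕ} {v : α → ℕ}
    (h : IsCounter l cs v) (f : α → Bool) :
    IsCounter l (addPlane cs (packBits l f)) fun a => v a + (f a).toNat := by
  induction cs generalizing v f with
  | nil => trivial
  | cons c cs ih =>
    obtain ⟨rfl, h⟩ := h
    refine ⟨?_, ?_⟩
    · rw [packBits_xor]
      congr 1; ext a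
      rcases Nat.mod_two_eq_zero_or_one (v a) with h | h <;> cases hf : f a <;>
        simp [Nat.testBit_zero, h, hf, Nat.add_mod]
    · rw [packBits_and]
      convert ih h _ using 2 with a
      rcases Nat.mod_two_eq_zero_or_one (v a) with h | h <;> cases hf : f a <;>
        simp [Nat.testBit_zero, h, hf] <;> omega

lemma isCounter_constPlanes {α : Type*} (l : List α) (f m : ℕ) :
    IsCounter l (constPlanes (packBits l fun _ => true) f m) fun _ => m := by
  induction f generalizing m with
  | zero => trivial
  | succ f ih => exact ⟨packBits_cond _ _, ih _⟩

lemma IsCounter.getD {α : Type*} {l : List α} {cs : List ℕ} {v : α → ℕ}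
    (h : IsCounter l cs v) {i : ℕ} (hi : i < cs.length) :
    cs.getD i 0 = packBits l fun a => (v a).testBit i := by
  induction cs generalizing v i with
  | nil => simp at hi
  | cons c cs ih =>
    cases i with
    | zero => exact h.1
    | succ i =>
      rw [List.getD_cons_succ, ih h.2 (by simpa using hi)]
      simp only [Nat.testBit_succ]

lemma length_addPlane (cs : List ℕ) (b : ℕ) : (addPlane cs b).length = cs.length := by
  induction cs generalizing b with
  | nil => rfl
  | cons c cs ih => simp [addPlane, ih]

lemma length_addAll (ones : ℕ) (o : List Bool) (ps cs : List ℕ) :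
    (addAll ones o ps cs).length = cs.length := by
  induction o generalizing ps cs with
  | nil => rfl
  | cons o os ih => cases ps <;> simp [addAll, ih, length_addPlane]

lemma length_constPlanes (ones f m : ℕ) : (constPlanes ones f m).length = f := by
  induction f generalizing m with
  | zero => rfl
  | succ f ih => simp [constPlanes, ih]

lemma IsCounter.addAll {l : List (Fin m → ZMod 2)} {cs : List ℕ} {v : (Fin m → ZMod 2) → ℕ}
    (h : IsCounter l cs v) (o : Fin m → ZMod 2) (c : List (Fin m)) :
    IsCounter l
      (addAll (packBits l fun _ => true) (c.map fun j => decide (o j ≠ 0))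
        (c.map fun j => packBits l fun v => decide (v j ≠ 0)) cs)
      fun a => v a + c.countP fun j => decide ((a + o) j ≠ 0) := by
  induction c generalizing cs v with
  | nil => simpa [_root_.addAll] using h
  | cons j c ih =>
    simp only [List.map_cons, _root_.addAll, packBits_cond, packBits_xor]
    convert ih (h.addPlane _) using 2 with a
    rw [List.countP_cons, Pi.add_apply, decide_add_ne_zero]
    cases (decide (a j ≠ 0) ^^ decide (o j ≠ 0)) <;> simp; omega

lemma countP_finRange (p : Fin m → Prop) [DecidablePred p] :
    (List.finRange m).countP (fun j => decide (p j)) = (Finset.univ.filter p).card := by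
  rw [List.countP_eq_length_filter]
  rfl

lemma wt_le (x : Fin m → ZMod 2) : wt x ≤ m :=
  (Finset.card_le_univ _).trans_eq (Fintype.card_fin m)

lemma countLE_blockOf (hm : m ≤ 64) (l : List (Fin m → ZMod 2)) (o t : ℕ) (ht : t ≤ 63) :
    (blockOf l).countLE (bitList m o) t = l.countP fun v => decide (wt (v + bitVec m o) ≤ t) := by
  have h := (isCounter_constPlanes l 7 (63 - t)).addAll (bitVec m o) (List.finRange m)
  rw [PlaneBlock.countLE, bitList_eq]
  simp only [blockOf]
  rw [h.getD (by rw [length_addAll, length_constPlanes]; norm_num), packBits_xor,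
    popCount_packBits _ _ _ List.countP_le_length]
  refine List.countP_congr fun v _ => ?_
  have hw := wt_le (v + bitVec m o)
  rw [countP_finRange fun j => (v + bitVec m o) j ≠ 0]
  change (true ^^ (63 - t + wt (v + bitVec m o)).testBit 6) = true ↔ _
  rw [Nat.testBit_eq_decide_div_mod_eq]
  simp only [Bool.true_xor, Bool.not_eq_true', decide_eq_false_iff_not, decide_eq_true_eq]
  omega

/-- The sums of the `k`-subsets of the first `n` vectors of the sequence `row`. -/
def subsetSums (row : ℕ → Fin m → ZMod 2) : ℕ → ℕ → List (Fin m → ZMod 2)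
  | 0, _ => [0]
  | _ + 1, 0 => []
  | k + 1, n + 1 => subsetSums row (k + 1) n ++ (subsetSums row k n).map (· + row n)

lemma subsetSums_zero (row : ℕ → Fin m → ZMod 2) (n : ℕ) : subsetSums row 0 n = [0] := by
  cases n <;> rfl

lemma mergeAll_subsetSums (row : ℕ → Fin m → ZMod 2) (n r i j : ℕ) (hr : row n = bitVec m r) :
    mergeAll (bitList m r) (blockOf (subsetSums row i n))
        ((List.range' (i + 1) j).map fun k => blockOf (subsetSums row k n)) =
      (List.range' (i + 1) j).map fun k => blockOf (subsetSums row k (n + 1)) := by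
  induction j generalizing i with
  | zero => rfl
  | succ j ih =>
    simp only [List.range'_succ, List.map_cons, mergeAll, ih, merge_blockOf, subsetSums, hr]

lemma countBlocks_subsetSums (hm : m ≤ 64) (row : ℕ → Fin m → ZMod 2) (n o t i j : ℕ)
    (ht : t ≤ 63) :
    countBlocks (bitList m o)
        ((List.range' i j).map fun k => blockOf (subsetSums row k n)) (t - i) =
      ((List.range' i j).map fun k =>
        (subsetSums row k n).countP fun v => decide (wt (v + bitVec m o) ≤ t - k)).sum := by
  induction j generalizing i with
  | zero => rfl
  | succ j ih =>
    simp only [List.range'_succ, List.map_cons, countBlocks, List.sum_cons,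
      countLE_blockOf hm _ _ _ ((Nat.sub_le t i).trans ht)]
    rw [Nat.sub_sub, ih]

lemma countRows_subsetSums (row : ℕ → Fin 41 → ZMod 2) (o t k n : ℕ) (ht : t ≤ 63)
    (rows : List ℕ) (hr : ∀ i (hi : i < rows.length), row (n + i) = bitVec 41 rows[i]) :
    countRows o t (blockOf (subsetSums row 0 n)) rows
        ((List.range' 1 k).map fun k => blockOf (subsetSums row k n)) +
      ((List.range' 0 (k + 1)).map fun k =>
        (subsetSums row (k + 1) n).countP fun v =>
          decide (wt (v + bitVec 41 o) ≤ t - k)).sum =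
      ((List.range' 0 (k + 1)).map fun k =>
        (subsetSums row (k + 1) (n + rows.length)).countP fun v =>
          decide (wt (v + bitVec 41 o) ≤ t - k)).sum := by
  induction rows generalizing n with
  | nil => simp [countRows]
  | cons r rs ih =>
    have h0 : row n = bitVec 41 r := hr 0 (by simp)
    have ih := ih (n + 1) fun i hi => by
      have := hr (i + 1) (by simpa using hi)
      simpa [add_assoc, add_comm 1 i] using this
    have e := countBlocks_subsetSums (by norm_num) row n (o ^^^ r) t 0 (k + 1) ht
    rw [List.range'_succ, List.map_cons, tsub_zero, zero_add] at e
    rw [countRows, e, mergeAll_subsetSums row n r 0 k h0]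
    simp only [subsetSums_zero] at ih ⊢
    rw [List.length_cons, show n + (rs.length + 1) = n + 1 + rs.length by ring, ← ih]
    simp only [subsetSums, List.countP_append, List.countP_map, List.sum_map_add,
      Function.comp_def, h0, bitVec_xor]
    rw [show (0 :: List.range' 1 k) = List.range' 0 (k + 1) by rw [List.range'_succ]]
    simp only [add_comm (bitVec 41 o), ← add_assoc, zero_add]
    ring

end Planes

section Weight

variable {m n : ℕ}

lemma wt_eq_sum (x : Fin m → ZMod 2) : wt x = ∑ i, if x i ≠ 0 then 1 else 0 :=
  Finset.card_filter _ _

lemma wt_eq_zero_iff (x : Fin m → ZMod 2) : wt x = 0 ↔ x = 0 := by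
  simp [wt, Finset.filter_eq_empty_iff, funext_iff]

lemma wt_append (x : Fin m → ZMod 2) (y : Fin n → ZMod 2) :
    wt (Fin.append x y) = wt x + wt y := by
  simp [wt_eq_sum, Fin.sum_univ_add]

lemma wt_snoc (x : Fin m → ZMod 2) (b : ZMod 2) :
    wt (Fin.snoc x b : Fin (m + 1) → ZMod 2) = wt x + if b ≠ 0 then 1 else 0 := by
  simp [wt_eq_sum, Fin.sum_univ_castSucc]

lemma countP_eq_sum {α : Type*} (p : α → Bool) (l : List α) :
    l.countP p = (l.map fun a => if p a then 1 else 0).sum := by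
  induction l with
  | nil => rfl
  | cons a l ih => rw [List.countP_cons, List.map_cons, List.sum_cons, ih, add_comm]

lemma sum_subsetSums (row : ℕ → Fin m → ZMod 2) (k n : ℕ) (g : (Fin m → ZMod 2) → ℕ) :
    ((subsetSums row k n).map g).sum =
      ∑ x : Fin n → ZMod 2, if wt x = k then g (∑ i, x i • row i) else 0 := by
  induction n generalizing k g with
  | zero => cases k <;> simp [subsetSums, wt]
  | succ n ih =>
    have h2 : ∀ f : ZMod 2 → ℕ, ∑ b, f b = f 0 + f 1 := fun f => Fin.sum_univ_two f
    have hw : ∀ b x, wt ((Fin.snocEquiv fun _ : Fin (n + 1) => ZMod 2) (b, x)) =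
        wt x + if b ≠ 0 then 1 else 0 := fun b x => wt_snoc x b
    rw [← (Fin.snocEquiv fun _ => ZMod 2).sum_comp, Fintype.sum_prod_type, h2]
    simp only [hw]
    simp only [Fin.snocEquiv_apply, Fin.sum_univ_castSucc, Fin.snoc_castSucc,
      Fin.snoc_last, Fin.val_castSucc, Fin.val_last, zero_smul, one_smul, add_zero, ne_eq,
      not_true_eq_false, if_false, one_ne_zero, not_false_eq_true, if_true]
    cases k with
    | zero => simpa [subsetSums_zero] using ih 0 g
    | succ k =>
      simp only [subsetSums, List.map_append, List.sum_append, List.map_map, ih,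
        add_left_inj, Function.comp_apply]

/-- The square matrix whose rows are given by the binary digits of a list of numbers. -/
def bitMatrix (m : ℕ) (rows : List ℕ) : Matrix (Fin m) (Fin m) (ZMod 2) :=
  fun i => bitVec m (rows.getD i 0)

open Matrix in
theorem countLow_eq_card (rows : List ℕ) (o k t : ℕ) (hrows : rows.length = 41) (hk : 1 ≤ k)
    (hkt : k ≤ t) (ht : t ≤ 64) {A : Matrix (Fin 41) (Fin 41) (ZMod 2)} (hA : bitMatrix 41 rows = A)
    {b : Fin 41 → ZMod 2} (hb : bitVec 41 o = b) :
    countLow rows o k t = (Finset.univ.filter fun x : Fin 41 → ZMod 2 =>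
      x ≠ 0 ∧ wt x ≤ k ∧ wt x + wt (x ᵥ* A + b) ≤ t).card := by
  subst hA hb
  obtain ⟨k, rfl⟩ := Nat.exists_eq_add_of_le' hk
  have h := countRows_subsetSums (fun i => bitVec 41 (rows.getD i 0)) o (t - 1) k 0 (by omega) rows
    fun i hi => by simp [hi]
  have h0 : (List.range' 1 k).map (fun k => blockOf
      (subsetSums (fun i => bitVec 41 (rows.getD i 0)) k 0)) =
      List.replicate k ⟨0, 0, List.replicate 41 0⟩ := by
    rw [List.map_congr_left (g := fun _ => (⟨0, 0, List.replicate 41 0⟩ : PlaneBlock)),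
      List.map_const', List.length_range']
    intro i hi
    obtain ⟨i, rfl⟩ := Nat.exists_eq_add_of_le' (List.mem_range'_1.1 hi).1
    rfl
  rw [h0, hrows] at h
  have h1 : blockOf (subsetSums (fun i => bitVec 41 (rows.getD i 0)) 0 0) =
      ⟨1, 1, List.replicate 41 0⟩ := rfl
  rw [h1] at h
  have h2 : ∀ i, subsetSums (fun i => bitVec 41 (rows.getD i 0)) (i + 1) 0 = [] := fun _ => rfl
  simp only [h2, List.countP_nil, List.map_const', List.sum_replicate, smul_zero,
    add_zero, zero_add] at h
  have h3 : ∀ i, (subsetSums (fun i => bitVec 41 (rows.getD i 0)) (i + 1) 41).countP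
      (fun v => decide (wt (v + bitVec 41 o) ≤ t - 1 - i)) =
      ∑ x : Fin 41 → ZMod 2, if wt x = i + 1 then
        (if wt (x ᵥ* bitMatrix 41 rows + bitVec 41 o) ≤ t - 1 - i then 1 else 0) else 0 := by
    intro i
    rw [countP_eq_sum, sum_subsetSums]
    simp only [Matrix.vecMul_eq_sum, bitMatrix, decide_eq_true_eq]
  rw [countLow, Nat.add_sub_cancel, h, ← List.range_eq_range', Finset.card_filter]
  simp only [h3]
  have h4 : ∀ f : ℕ → ℕ, ((List.range (k + 1)).map f).sum = ∑ i ∈ Finset.range (k + 1), f i :=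
    fun _ => rfl
  rw [h4, Finset.sum_comm]
  refine Finset.sum_congr rfl fun x _ => ?_
  rcases hx : wt x with _ | j
  · simp [(wt_eq_zero_iff x).1 hx]
  · have hx0 : x ≠ 0 := fun h => by simp [(wt_eq_zero_iff x).2 h] at hx
    simp only [add_left_inj, Finset.sum_ite_eq, Finset.mem_range, hx0, ne_eq, not_false_eq_true,
      true_and]
    split_ifs <;> omega

end Weight

section MacWilliams

open Polynomial

/-- The nontrivial additive character of `ZMod 2`. -/
def signChar : AddChar (ZMod 2) ℤ where
  toFun z := if z = 0 then 1 else -1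
  map_zero_eq_one' := by decide
  map_add_eq_mul' := by decide

variable {m : ℕ}

lemma signChar_sum {ι : Type*} (t : Finset ι) (f : ι → ZMod 2) :
    signChar (∑ i ∈ t, f i) = ∏ i ∈ t, signChar (f i) := by
  induction t using Finset.cons_induction with
  | empty => simp
  | cons a t h ih => simp [AddChar.map_add_eq_mul, ih]

lemma one_sub_X_pow_mul (v : Fin m → ZMod 2) :
    (1 - X : ℤ[X]) ^ wt v * (1 + X) ^ (m - wt v) =
      ∑ u : Fin m → ZMod 2, C (signChar (∑ i, u i * v i)) * X ^ wt u := by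
  have h2 : ∀ f : ZMod 2 → ℤ[X], ∑ b, f b = f 0 + f 1 := fun f => Fin.sum_univ_two f
  have hl : (1 - X : ℤ[X]) ^ wt v * (1 + X) ^ (m - wt v) =
      ∏ i, ∑ b : ZMod 2, C (signChar (b * v i)) * (if b ≠ 0 then X else 1) := by
    have hi : ∀ i, ∑ b : ZMod 2, C (signChar (b * v i)) * (if b ≠ 0 then X else 1) =
        if v i ≠ 0 then (1 - X : ℤ[X]) else 1 + X := by
      intro i
      rw [h2]
      by_cases h : v i = 0 <;> simp [h, signChar, sub_eq_add_neg]
    have hc : (Finset.univ.filter fun i => ¬ v i ≠ 0).card = m - wt v := by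
      have := Finset.card_filter_add_card_filter_not (s := Finset.univ) fun i => v i ≠ 0
      rw [Finset.card_univ, Fintype.card_fin] at this
      rw [wt]
      omega
    rw [Finset.prod_congr rfl fun i _ => hi i, Finset.prod_ite, Finset.prod_const,
      Finset.prod_const, hc, wt]
  rw [hl, Finset.prod_univ_sum, Fintype.piFinset_univ]
  refine Finset.sum_congr rfl fun u _ => ?_
  rw [Finset.prod_mul_distrib, signChar_sum, map_prod]
  congr 1
  rw [Finset.prod_ite, Finset.prod_const, Finset.prod_const_one, mul_one, wt]

lemma sum_signChar (D : Submodule (ZMod 2) (Fin m → ZMod 2)) [Fintype D]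
    (hD : ∀ x, x ∈ D ↔ ∀ y ∈ D, ∑ i, x i * y i = 0) (u : Fin m → ZMod 2) [Decidable (u ∈ D)] :
    ∑ c : D, signChar (∑ i, u i * (c : Fin m → ZMod 2) i) =
      if u ∈ D then (Fintype.card D : ℤ) else 0 := by
  classical
  let ψ : AddChar D ℤ :=
    { toFun := fun c => signChar (∑ i, u i * (c : Fin m → ZMod 2) i)
      map_zero_eq_one' := by simp
      map_add_eq_mul' := fun a b => by
        simp [mul_add, Finset.sum_add_distrib, AddChar.map_add_eq_mul] }
  have h := AddChar.sum_eq_ite ψ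
  have hs : ∀ z : ZMod 2, signChar z = 1 ↔ z = 0 := by decide
  have : ψ = 0 ↔ u ∈ D := by
    rw [hD, DFunLike.ext_iff]
    exact ⟨fun h y hy => (hs _).1 (h ⟨y, hy⟩), fun h c => (hs _).2 (h c c.2)⟩
  simp only [this] at h
  exact h

/-- MacWilliams identity for the weight enumerator of a coset of a self-dual code. -/
theorem sum_coset_weights (D : Submodule (ZMod 2) (Fin m → ZMod 2)) [Fintype D]
    (hD : ∀ x, x ∈ D ↔ ∀ y ∈ D, ∑ i, x i * y i = 0) (s : Fin m → ZMod 2) :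
    ∑ c : D, (1 - X : ℤ[X]) ^ wt (s + (c : Fin m → ZMod 2)) *
        (1 + X) ^ (m - wt (s + (c : Fin m → ZMod 2))) =
      (Fintype.card D : ℤ[X]) *
        ∑ c : D, C (signChar (∑ i, s i * (c : Fin m → ZMod 2) i)) *
          X ^ wt (c : Fin m → ZMod 2) := by
  classical
  have h : ∀ u : Fin m → ZMod 2,
      ∑ c : D, C (signChar (∑ i, u i * (s + (c : Fin m → ZMod 2)) i)) * X ^ wt u =
        if u ∈ D then C (signChar (∑ i, s i * u i)) * X ^ wt u * (Fintype.card D : ℤ[X])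
        else 0 := by
    intro u
    simp only [Pi.add_apply, mul_add, Finset.sum_add_distrib, AddChar.map_add_eq_mul, map_mul]
    rw [← Finset.sum_mul, ← Finset.mul_sum, ← map_sum, sum_signChar D hD]
    split_ifs
    · simp only [mul_comm (u _), map_natCast]; ring
    · simp
  simp only [one_sub_X_pow_mul]
  rw [Finset.sum_comm]
  simp only [h]
  rw [← Finset.sum_filter, Finset.mul_sum,
    Finset.sum_subtype (p := (· ∈ D)) _ (by simp)]
  exact Finset.sum_congr rfl fun c _ => mul_comm _ _

end MacWilliams

section Encode

open Matrix

variable {m n : ℕ} (A : Matrix (Fin m) (Fin n) (ZMod 2))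

/-- The systematic encoder `x ↦ (x, x A)`. -/
def encode : (Fin m → ZMod 2) →ₗ[ZMod 2] (Fin (m + n) → ZMod 2) where
  toFun x := Fin.append x (x ᵥ* A)
  map_add' x y := by
    ext i
    refine Fin.addCases (fun i => ?_) (fun i => ?_) i <;> simp [add_vecMul]
  map_smul' a x := by
    ext i
    refine Fin.addCases (fun i => ?_) (fun i => ?_) i <;> simp [smul_vecMul]

lemma encode_apply (x : Fin m → ZMod 2) : encode A x = Fin.append x (x ᵥ* A) := rfl

lemma encode_injective : Function.Injective (encode A) := fun x y h => by
  ext i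
  simpa [encode_apply] using congrFun h (Fin.castAdd n i)

lemma wt_append_add_encode (a x : Fin m → ZMod 2) (b : Fin n → ZMod 2) :
    wt (Fin.append a b + encode A x) = wt (a + x) + wt (x ᵥ* A + b) := by
  rw [← wt_append]
  congr 1
  ext i
  refine Fin.addCases (fun i => ?_) (fun i => ?_) i <;> simp [encode_apply, add_comm]

lemma sum_append_mul_encode (a x : Fin m → ZMod 2) (b : Fin n → ZMod 2) :
    ∑ i, Fin.append a b i * encode A x i = a ⬝ᵥ x + b ⬝ᵥ (x ᵥ* A) := by
  simp [Fin.sum_univ_add, encode_apply, dotProduct]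

lemma mem_range_encode_iff (hA : A * Aᵀ = 1) (hA' : Aᵀ * A = 1)
    (x : Fin (m + n) → ZMod 2) :
    x ∈ LinearMap.range (encode A) ↔ ∀ y ∈ LinearMap.range (encode A), ∑ i, x i * y i = 0 := by
  obtain ⟨a, b, rfl⟩ : ∃ a b, x = Fin.append a b :=
    ⟨fun i => x (Fin.castAdd n i), fun i => x (Fin.natAdd m i), by
      ext i; refine Fin.addCases (fun i => ?_) (fun i => ?_) i <;> simp⟩
  have h : ∀ u, ∑ i, Fin.append a b i * encode A u i = (a + A *ᵥ b) ⬝ᵥ u := by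
    intro u
    rw [sum_append_mul_encode, add_dotProduct, dotProduct_comm (A *ᵥ b), dotProduct_mulVec,
      dotProduct_comm _ b]
  simp only [LinearMap.mem_range, forall_exists_index, forall_apply_eq_imp_iff, h]
  rw [dotProduct_eq_zero_iff, add_eq_zero_iff_eq_neg, ZModModule.neg_eq_self]
  constructor
  · rintro ⟨u, hu⟩
    have h1 : u = a := by
      ext i; simpa [encode_apply] using congrFun hu (Fin.castAdd n i)
    have h2 : u ᵥ* A = b := by
      ext i; simpa [encode_apply] using congrFun hu (Fin.natAdd m i)
    rw [← h2, ← mulVec_transpose, mulVec_mulVec, hA, one_mulVec, h1]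
  · rintro rfl
    refine ⟨A *ᵥ b, ?_⟩
    rw [encode_apply, ← mulVec_transpose, mulVec_mulVec, hA', one_mulVec]

end Encode

section ModFour

variable {m : ℕ}

lemma wt_cast (x : Fin m → ZMod 2) : (wt x : ZMod 4) = ∑ i, ((x i).val : ZMod 4) := by
  rw [wt_eq_sum, Nat.cast_sum]
  refine Finset.sum_congr rfl fun i _ => ?_
  generalize x i = z
  revert z
  decide

lemma two_mul_val_sum {ι : Type*} (t : Finset ι) (f : ι → ZMod 2) :
    ∑ i ∈ t, 2 * ((f i).val : ZMod 4) = 2 * ((∑ i ∈ t, f i).val : ZMod 4) := by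
  have h : ∀ a b : ZMod 2, 2 * ((a + b).val : ZMod 4) = 2 * (a.val : ZMod 4) + 2 * b.val := by
    decide
  induction t using Finset.cons_induction with
  | empty => simp
  | cons a t ha ih => rw [Finset.sum_cons, Finset.sum_cons, h, ih]

lemma wt_add_cast (x y : Fin m → ZMod 2) :
    (wt (x + y) : ZMod 4) = wt x + wt y + 2 * ((∑ i, x i * y i).val : ZMod 4) := by
  have h : ∀ a b : ZMod 2, ((a + b).val : ZMod 4) = a.val + b.val + 2 * ((a * b).val : ZMod 4) := by
    decide
  simp only [wt_cast, ← two_mul_val_sum, ← Finset.sum_add_distrib, Pi.add_apply, h]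

lemma two_dvd_wt {x : Fin m → ZMod 2} (h : ∑ i, x i * x i = 0) : 2 ∣ wt x := by
  have h2 : ∀ z : ZMod 2, z * z = if z ≠ 0 then 1 else 0 := by decide
  rw [← ZMod.natCast_eq_zero_iff, wt_eq_sum, Nat.cast_sum]
  refine Eq.trans (Finset.sum_congr rfl fun i _ => ?_) h
  rw [h2, Nat.cast_ite, Nat.cast_one, Nat.cast_zero]

/-- On a self-orthogonal code the condition `wt c ≡ 2 (s · c) mod 4` needs to be checked on
generators only. -/
lemma wt_cast_of_span (D : Submodule (ZMod 2) (Fin m → ZMod 2))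
    (hD : ∀ x ∈ D, ∀ y ∈ D, ∑ i, x i * y i = 0) (s : Fin m → ZMod 2)
    (S : Set (Fin m → ZMod 2)) (hS : Submodule.span (ZMod 2) S = D)
    (h : ∀ x ∈ S, (wt x : ZMod 4) = 2 * ((∑ i, s i * x i).val : ZMod 4))
    {x : Fin m → ZMod 2} (hx : x ∈ D) :
    (wt x : ZMod 4) = 2 * ((∑ i, s i * x i).val : ZMod 4) := by
  have h4 : ∀ a b : ZMod 2, 2 * ((a + b).val : ZMod 4) = 2 * (a.val : ZMod 4) + 2 * b.val := by
    decide
  subst hS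
  induction hx using Submodule.span_induction with
  | mem x hx => exact h x hx
  | zero => simp [wt]
  | add x y hx hy ihx ihy =>
    simp only [wt_add_cast, hD x hx y hy, ihx, ihy, Pi.add_apply, mul_add,
      Finset.sum_add_distrib, h4, ZMod.val_zero, Nat.cast_zero, mul_zero, add_zero]
  | smul a x hx ih =>
    obtain rfl | rfl : a = 0 ∨ a = 1 := by revert a; decide
    · simp [wt]
    · rwa [one_smul]

lemma wt_one_add (x : Fin m → ZMod 2) : wt (1 + x) = m - wt x := by
  have := Finset.card_filter_add_card_filter_not (s := Finset.univ) fun i => x i ≠ 0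
  have h : ∀ z : ZMod 2, 1 + z ≠ 0 ↔ ¬ z ≠ 0 := by decide
  rw [Finset.card_univ, Fintype.card_fin] at this
  simp only [wt, Pi.add_apply, Pi.one_apply, h]
  omega

end ModFour

section Krawtchouk

open Polynomial

/-- Multiplication of a truncated power series, given by its list of coefficients, by `1 + e X`;
the number `c` is the coefficient preceding the list. -/
def mulLinear (e : ℤ) : ℤ → List ℤ → List ℤ
  | _, [] => []
  | c, a :: l => (a + e * c) :: mulLinear e a l

/-- The first `n + 1` coefficients of `(1 - X) ^ j * (1 + X) ^ k`. -/
def krawtchoukList (n j k : ℕ) : List ℤ :=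
  (mulLinear (-1) 0)^[j] ((mulLinear 1 0)^[k] (1 :: List.replicate n 0))

lemma mulLinear_coeff (e : ℤ) (p : ℤ[X]) (k n : ℕ) :
    mulLinear e (p.coeff k) ((List.range' (k + 1) n).map p.coeff) =
      (List.range' (k + 1) n).map ((1 + C e * X) * p).coeff := by
  induction n generalizing k with
  | zero => rfl
  | succ n ih =>
    rw [List.range'_succ, List.map_cons, List.map_cons, mulLinear, ih, add_mul, one_mul, mul_assoc,
      coeff_add, coeff_C_mul, coeff_X_mul]

lemma mulLinear_zero_coeff (e : ℤ) (p : ℤ[X]) (n : ℕ) :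
    mulLinear e 0 ((List.range' 0 (n + 1)).map p.coeff) =
      (List.range' 0 (n + 1)).map ((1 + C e * X) * p).coeff := by
  rw [List.range'_succ, List.map_cons, List.map_cons, mulLinear, mulLinear_coeff]
  simp [mul_coeff_zero]

lemma krawtchoukList_eq (n j k : ℕ) :
    krawtchoukList n j k =
      (List.range' 0 (n + 1)).map ((1 - X : ℤ[X]) ^ j * (1 + X) ^ k).coeff := by
  have h (e : ℤ) (i : ℕ) (p : ℤ[X]) :
      (mulLinear e 0)^[i] ((List.range' 0 (n + 1)).map p.coeff) =
        (List.range' 0 (n + 1)).map ((1 + C e * X) ^ i * p).coeff := by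
    induction i with
    | zero => simp
    | succ i ih => rw [Function.iterate_succ_apply', ih, mulLinear_zero_coeff, pow_succ', mul_assoc]
  have h0 : (1 :: List.replicate n 0 : List ℤ) = (List.range' 0 (n + 1)).map (1 : ℤ[X]).coeff := by
    rw [List.range'_succ, List.map_cons, coeff_one_zero,
      List.map_congr_left (g := fun _ => (0 : ℤ)), List.map_const', List.length_range']
    intro i hi
    rw [coeff_one, if_neg (by simp at hi; omega)]
  rw [krawtchoukList, h0, h, h]
  simp [sub_eq_add_neg]

/-- The linear functional on polynomials given by weights of the coefficients. -/
noncomputable def weigh (l : List ℤ) : ℤ[X] →ₗ[ℤ] ℤ :=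
  ∑ i ∈ Finset.range l.length, l.getD i 0 • lcoeff ℤ i

lemma weigh_apply (l : List ℤ) (p : ℤ[X]) :
    weigh l p = ∑ i ∈ Finset.range l.length, l.getD i 0 * p.coeff i := by
  simp [weigh]

lemma weigh_C_mul_X_pow (l : List ℤ) (a : ℤ) (w : ℕ) :
    weigh l (C a * X ^ w) = a * l.getD w 0 := by
  rw [weigh_apply]
  simp only [coeff_C_mul_X_pow, mul_ite, mul_zero, Finset.sum_ite_eq', Finset.mem_range, mul_comm a]
  split_ifs with h
  · rfl
  · rw [List.getD_eq_default _ _ (by omega), zero_mul]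

lemma weigh_krawtchouk (l : List ℤ) (n j k : ℕ) (hl : l.length = n + 1) :
    weigh l ((1 - X : ℤ[X]) ^ j * (1 + X) ^ k) =
      (List.zipWith (· * ·) l (krawtchoukList n j k)).sum := by
  have h (p : ℤ[X]) (i : ℕ) (l : List ℤ) :
      (List.zipWith (· * ·) l ((List.range' i l.length).map p.coeff)).sum =
        ∑ k ∈ Finset.range l.length, l.getD k 0 * p.coeff (i + k) := by
    induction l generalizing i with
    | nil => rfl
    | cons a l ih =>
      rw [List.length_cons, List.range'_succ, List.map_cons, List.zipWith_cons_cons, List.sum_cons,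
        ih, Finset.sum_range_succ']
      simp [add_comm, add_left_comm]
  rw [weigh_apply, krawtchoukList_eq, ← hl, h]
  simp

end Krawtchouk

section Facts

open Matrix

/-- The matrix `A` for which `(1 | A)` generates the code. -/
def genMatrix : Matrix (Fin 41) (Fin 41) (ZMod 2) := bitMatrix 41 rowBits

lemma bitMatrix_rowBits : bitMatrix 41 rowBits = genMatrix := rfl

lemma bitMatrix_colBits : bitMatrix 41 colBits = genMatrixᵀ := by
  have h : ∀ i j : Fin 41, (colBits.getD i 0).testBit j = (rowBits.getD j 0).testBit i := by
    decide +kernel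
  ext i j
  simp only [genMatrix, transpose_apply, bitMatrix, bitVec, h]

lemma genMatrix_mul_transpose : genMatrix * genMatrixᵀ = 1 := by
  have h : ∀ i j : Fin 41, ∑ k, genMatrix i k * genMatrix j k = if i = j then 1 else 0 := by
    decide +kernel
  ext i j
  rw [mul_apply, one_apply]
  exact h i j

lemma one_vecMul_genMatrix : (1 : Fin 41 → ZMod 2) ᵥ* genMatrix = 1 := by
  have h : ∀ j : Fin 41, ∑ i, genMatrix i j = 1 := by decide +kernel
  ext j
  simpa [vecMul, dotProduct] using h j

/-- The nonzero right half of a vector of weight 5 in the shadow of the code. -/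
def shadowRight : Fin 41 → ZMod 2 := bitVec 41 2130303778816

lemma bitVec_shadow : bitVec 41 2130303778816 = shadowRight := rfl

lemma shadowRight_vecMul : shadowRight ᵥ* genMatrixᵀ = bitVec 41 1286157689744 := by
  have h : ∀ i : Fin 41, ∑ j, shadowRight j * genMatrix i j = bitVec 41 1286157689744 i := by
    decide +kernel
  ext i
  exact h i

lemma wt_shadowRight : wt shadowRight = 5 := by decide +kernel

lemma wt_shadowRight_vecMul : wt (bitVec 41 1286157689744) = 21 := by decide +kernel

lemma wt_genMatrix (i : Fin 41) : ((1 + wt (genMatrix i) : ℕ) : ZMod 4) =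
    2 * ((∑ j, shadowRight j * genMatrix i j).val : ZMod 4) := by
  revert i
  decide +kernel

set_option maxRecDepth 100000 in
lemma countLow_rowBits_zero : countLow rowBits 0 6 12 = 0 := by decide +kernel

set_option maxRecDepth 100000 in
lemma countLow_colBits_zero : countLow colBits 0 5 12 = 0 := by decide +kernel

set_option maxRecDepth 100000 in
lemma countLow_rowBits_nine : countLow rowBits 2130303778816 4 9 = 0 := by decide +kernel

set_option maxRecDepth 100000 in
lemma countLow_colBits_nine : countLow colBits 1286157689744 4 9 = 0 := by decide +kernel

set_option maxRecDepth 100000 in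
lemma countLow_rowBits_thirteen : countLow rowBits 2130303778816 6 13 = 302 := by decide +kernel

set_option maxRecDepth 100000 in
lemma countLow_colBits_thirteen : countLow colBits 1286157689744 6 13 = 302 := by decide +kernel

attribute [irreducible] genMatrix shadowRight

end Facts

section EncodeWeights

open Matrix

variable {m n : ℕ} (A : Matrix (Fin m) (Fin n) (ZMod 2))

lemma wt_encode (x : Fin m → ZMod 2) : wt (encode A x) = wt x + wt (x ᵥ* A) :=
  wt_append _ _

lemma two_dvd_wt_encode (hA : ∀ x, x ∈ LinearMap.range (encode A) ↔
    ∀ y ∈ LinearMap.range (encode A), ∑ i, x i * y i = 0)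
    (x : Fin m → ZMod 2) : 2 ∣ wt (encode A x) :=
  two_dvd_wt ((hA _).1 (LinearMap.mem_range_self _ x) _ (LinearMap.mem_range_self _ x))

lemma wt_encode_cast (hA : ∀ x, x ∈ LinearMap.range (encode A) ↔
    ∀ y ∈ LinearMap.range (encode A), ∑ i, x i * y i = 0)
    (s : Fin n → ZMod 2)
    (h : ∀ i, ((1 + wt (A i) : ℕ) : ZMod 4) = 2 * ((∑ j, s j * A i j).val : ZMod 4))
    (x : Fin m → ZMod 2) :
    (wt (encode A x) : ZMod 4) = 2 * ((s ⬝ᵥ (x ᵥ* A)).val : ZMod 4) := by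
  have hs : ∀ x, s ⬝ᵥ (x ᵥ* A) = ∑ i, Fin.append 0 s i * encode A x i := fun x => by
    rw [sum_append_mul_encode, zero_dotProduct, zero_add]
  rw [hs]
  refine wt_cast_of_span (LinearMap.range (encode A)) (fun x => (hA x).1) _
    (Set.range fun i => encode A (Pi.single i 1)) ?_ ?_ (LinearMap.mem_range_self _ x)
  · have h := (Pi.basisFun (ZMod 2) (Fin m)).span_eq
    rw [LinearMap.range_eq_map, ← h, Submodule.map_span, ← Set.range_comp]
    congr 2
    ext i : 1
    simp
  · rintro _ ⟨i, rfl⟩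
    have h1 : wt (Pi.single i 1 : Fin m → ZMod 2) = 1 := by
      simp [wt_eq_sum, Pi.single_apply]
    rw [← hs, wt_encode, h1, single_one_vecMul]
    exact h i

lemma card_wt_encode_zero : (Finset.univ.filter fun x => wt (encode A x) = 0).card = 1 := by
  rw [Finset.card_eq_one]
  refine ⟨0, ?_⟩
  ext x
  simp only [Finset.mem_filter, Finset.mem_univ, true_and, Finset.mem_singleton, wt_eq_zero_iff,
    map_eq_zero_iff _ (encode_injective A)]

lemma ncard_range_encode (w : ℕ) :
    {x | x ∈ LinearMap.range (encode A) ∧ wt x = w}.ncard =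
      (Finset.univ.filter fun x => wt (encode A x) = w).card := by
  have h : {x | x ∈ LinearMap.range (encode A) ∧ wt x = w} =
      encode A '' ↑(Finset.univ.filter fun x => wt (encode A x) = w) := by
    ext y
    simp only [Set.mem_ofPred_eq, LinearMap.mem_range, Set.mem_image, Finset.coe_filter,
      Finset.mem_univ, true_and]
    exact ⟨fun ⟨⟨x, hx⟩, hw⟩ => ⟨x, hx ▸ hw, hx⟩, fun ⟨x, hw, hx⟩ => ⟨⟨x, hx⟩, hx ▸ hw⟩⟩
  rw [h, Set.ncard_image_of_injective _ (encode_injective _), Set.ncard_coe_finset]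

lemma exists_mem_range_encode {w : ℕ} (hw : w ≠ 0)
    (h : (Finset.univ.filter fun x => wt (encode A x) = w).card ≠ 0) :
    ∃ y ∈ LinearMap.range (encode A), y ≠ 0 ∧ wt y = w := by
  obtain ⟨x, hx⟩ := Finset.card_ne_zero.1 h
  rw [Finset.mem_filter] at hx
  refine ⟨encode A x, ⟨x, rfl⟩, fun h0 => hw ?_, hx.2⟩
  rw [← hx.2, h0, (wt_eq_zero_iff _).2 rfl]

open Polynomial in
theorem sum_coset_weights_encode (hA : ∀ x, x ∈ LinearMap.range (encode A) ↔
    ∀ y ∈ LinearMap.range (encode A), ∑ i, x i * y i = 0)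
    (a : Fin m → ZMod 2) (b : Fin n → ZMod 2) :
    ∑ x, (1 - X : ℤ[X]) ^ (wt (a + x) + wt (x ᵥ* A + b)) *
        (1 + X) ^ (m + n - (wt (a + x) + wt (x ᵥ* A + b))) =
      (2 ^ m : ℤ) • ∑ x, C (signChar (a ⬝ᵥ x + b ⬝ᵥ (x ᵥ* A))) * X ^ wt (encode A x) := by
  classical
  let e := LinearEquiv.ofInjective (encode A) (encode_injective _)
  have hc : Fintype.card (LinearMap.range (encode A)) = 2 ^ m := by
    rw [← Fintype.card_congr e.toEquiv, Fintype.card_fun, ZMod.card, Fintype.card_fin]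
  have h := sum_coset_weights _ hA (Fin.append a b)
  rw [← e.toEquiv.sum_comp, ← e.toEquiv.sum_comp, hc] at h
  have he : ∀ x, ((e.toEquiv x : LinearMap.range (encode A)) : Fin (m + n) → ZMod 2) =
    encode A x := fun _ => rfl
  simp only [he, wt_append_add_encode, sum_append_mul_encode] at h
  rw [h, zsmul_eq_mul]
  norm_num

end EncodeWeights

section Main

open Matrix

lemma transpose_mul_genMatrix : genMatrixᵀ * genMatrix = 1 :=
  (mul_eq_one_comm_of_equiv (Equiv.refl (Fin 41))).1 genMatrix_mul_transpose

/-- The weights of the vectors in the coset of the code of `(0, shadowRight)`. -/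
def shadowWt (x : Fin 41 → ZMod 2) : ℕ := wt x + wt (x ᵥ* genMatrix + shadowRight)

lemma wt_add_encode (x : Fin 41 → ZMod 2) :
    wt (Fin.append 0 shadowRight + encode genMatrix x) = shadowWt x := by
  rw [wt_append_add_encode, zero_add, shadowWt]

lemma mem_code_iff (x : Fin (41 + 41) → ZMod 2) :
    x ∈ LinearMap.range (encode genMatrix) ↔
      ∀ y ∈ LinearMap.range (encode genMatrix), ∑ i, x i * y i = 0 :=
  mem_range_encode_iff _ genMatrix_mul_transpose transpose_mul_genMatrix x

lemma wt_encode_genMatrix_cast (x : Fin 41 → ZMod 2) : (wt (encode genMatrix x) : ZMod 4) =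
    2 * ((shadowRight ⬝ᵥ (x ᵥ* genMatrix)).val : ZMod 4) :=
  wt_encode_cast _ mem_code_iff _ wt_genMatrix x

lemma shadowWt_mod_four (x : Fin 41 → ZMod 2) : shadowWt x % 4 = 1 := by
  have h : ((shadowWt x : ℕ) : ZMod 4) = (1 : ℕ) := by
    have h0 : ∀ z : ZMod 2, 2 * (z.val : ZMod 4) + 2 * z.val = 0 := by decide
    have h5 : wt (Fin.append (0 : Fin 41 → ZMod 2) shadowRight) = 5 := by
      rw [wt_append, wt_shadowRight, (wt_eq_zero_iff _).2 rfl]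
    rw [← wt_add_encode, wt_add_cast, h5, sum_append_mul_encode, zero_dotProduct, zero_add,
      wt_encode_genMatrix_cast, add_assoc, h0]
    rfl
  exact (ZMod.natCast_eq_natCast_iff' _ _ 4).1 h

lemma vecMul_mul_transpose (x : Fin 41 → ZMod 2) : (x ᵥ* genMatrix) ᵥ* genMatrixᵀ = x := by
  rw [vecMul_vecMul, genMatrix_mul_transpose, vecMul_one]

lemma shadow_vecMul_transpose (x : Fin 41 → ZMod 2) :
    (x ᵥ* genMatrix + shadowRight) ᵥ* genMatrixᵀ + bitVec 41 1286157689744 = x := by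
  rw [add_vecMul, vecMul_mul_transpose, shadowRight_vecMul, add_assoc, ZModModule.add_self,
    add_zero]

lemma le_wt_encode {x : Fin 41 → ZMod 2} (hx : x ≠ 0) : 14 ≤ wt (encode genMatrix x) := by
  have hb : ∀ v : Fin 41 → ZMod 2, v + bitVec 41 0 = v := fun v => by
    ext i; simp [bitVec]
  have h2 := two_dvd_wt_encode _ mem_code_iff x
  by_contra! hlt
  have hl := countLow_rowBits_zero
  have hr := countLow_colBits_zero
  rw [countLow_eq_card _ _ _ _ rfl (by norm_num) (by norm_num) (by norm_num)
    bitMatrix_rowBits rfl, Finset.card_eq_zero, Finset.filter_eq_empty_iff] at hl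
  rw [countLow_eq_card _ _ _ _ rfl (by norm_num) (by norm_num) (by norm_num)
    bitMatrix_colBits rfl, Finset.card_eq_zero, Finset.filter_eq_empty_iff] at hr
  simp only [Finset.mem_univ, true_implies] at hl hr
  simp only [hb] at hl hr
  have hxx := vecMul_mul_transpose x
  have hx' : x ᵥ* genMatrix ≠ 0 := fun h => hx (by rw [← hxx, h, zero_vecMul])
  have hl := fun h6 h12 => @hl x ⟨hx, h6, h12⟩
  have hr := fun h5 h12 => @hr (x ᵥ* genMatrix) ⟨hx', h5, h12⟩
  rw [hxx] at hr
  rw [wt_encode] at hlt h2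
  by_cases h6 : wt x ≤ 6
  · exact hl h6 (by omega)
  · exact hr (by omega) (by omega)

lemma shadow_right_ne_zero {x : Fin 41 → ZMod 2} (h : shadowWt x ≤ 13) :
    x ᵥ* genMatrix + shadowRight ≠ 0 := by
  intro h0
  have := shadow_vecMul_transpose x
  rw [h0, zero_vecMul, zero_add] at this
  rw [shadowWt, ← this, wt_shadowRight_vecMul] at h
  omega

lemma shadowWt_zero : shadowWt 0 = 5 := by
  rw [shadowWt, zero_vecMul, zero_add, wt_shadowRight, (wt_eq_zero_iff _).2 rfl]

lemma eq_zero_of_shadowWt_le {x : Fin 41 → ZMod 2} (h : shadowWt x ≤ 9) : x = 0 := by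
  by_contra hx
  have hx' := shadow_right_ne_zero (x := x) (by omega)
  have hl := countLow_rowBits_nine
  have hr := countLow_colBits_nine
  rw [countLow_eq_card _ _ _ _ rfl (by norm_num) (by norm_num) (by norm_num)
    bitMatrix_rowBits bitVec_shadow, Finset.card_eq_zero, Finset.filter_eq_empty_iff] at hl
  rw [countLow_eq_card _ _ _ _ rfl (by norm_num) (by norm_num) (by norm_num)
    bitMatrix_colBits rfl, Finset.card_eq_zero, Finset.filter_eq_empty_iff] at hr
  simp only [Finset.mem_univ, true_implies] at hl hr
  have hl := fun h4 => @hl x ⟨hx, h4, h⟩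
  have hr := fun h4 h9 => @hr (x ᵥ* genMatrix + shadowRight) ⟨hx', h4, h9⟩
  rw [shadow_vecMul_transpose] at hr
  rw [shadowWt] at h
  by_cases h4 : wt x ≤ 4
  · exact hl h4
  · exact hr (by omega) (by omega)

lemma card_shadowWt_five : (Finset.univ.filter fun x => shadowWt x = 5).card = 1 := by
  rw [Finset.card_eq_one]
  refine ⟨0, ?_⟩
  ext x
  simp only [Finset.mem_filter, Finset.mem_univ, true_and, Finset.mem_singleton]
  exact ⟨fun h => eq_zero_of_shadowWt_le (by omega), fun h => h ▸ shadowWt_zero⟩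

lemma card_shadowWt_thirteen : (Finset.univ.filter fun x => shadowWt x = 13).card = 603 := by
  have hl := countLow_rowBits_thirteen
  have hr := countLow_colBits_thirteen
  rw [countLow_eq_card _ _ _ _ rfl (by norm_num) (by norm_num) (by norm_num)
    bitMatrix_rowBits bitVec_shadow] at hl
  rw [countLow_eq_card _ _ _ _ rfl (by norm_num) (by norm_num) (by norm_num)
    bitMatrix_colBits rfl] at hr
  have e : Function.Bijective fun x : Fin 41 → ZMod 2 => x ᵥ* genMatrix + shadowRight :=
    Finite.injective_iff_bijective.1 fun x y h => by
      have h : x ᵥ* genMatrix + shadowRight = y ᵥ* genMatrix + shadowRight := h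
      rw [← shadow_vecMul_transpose x, h, shadow_vecMul_transpose]
  have hr' : (Finset.univ.filter fun x : Fin 41 → ZMod 2 =>
      wt (x ᵥ* genMatrix + shadowRight) ≤ 6 ∧
        wt x + wt (x ᵥ* genMatrix + shadowRight) ≤ 13).card = 302 := by
    rw [← hr]
    refine Finset.card_equiv (Equiv.ofBijective _ e) fun x => ?_
    simp only [Finset.mem_filter, Finset.mem_univ, true_and, Equiv.ofBijective_apply,
      shadow_vecMul_transpose]
    rw [add_comm (wt _) (wt x)]
    exact ⟨fun h => ⟨shadow_right_ne_zero h.2, h⟩, fun h => h.2⟩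
  have hd : Disjoint (Finset.univ.filter fun x =>
        x ≠ 0 ∧ wt x ≤ 6 ∧ wt x + wt (x ᵥ* genMatrix + shadowRight) ≤ 13)
      (Finset.univ.filter fun x : Fin 41 → ZMod 2 =>
        wt (x ᵥ* genMatrix + shadowRight) ≤ 6 ∧ wt x + wt (x ᵥ* genMatrix + shadowRight) ≤ 13) := by
    rw [Finset.disjoint_filter]
    rintro x - ⟨hx, h6, -⟩ ⟨h6', -⟩
    have h4 := shadowWt_mod_four x
    refine hx (eq_zero_of_shadowWt_le ?_)
    rw [shadowWt] at h4 ⊢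
    omega
  have h0 : (0 : Fin 41 → ZMod 2) ∉ Finset.univ.filter fun x => shadowWt x = 13 := by
    simp [shadowWt_zero]
  have hu : insert 0 (Finset.univ.filter fun x => shadowWt x = 13) =
      (Finset.univ.filter fun x =>
        x ≠ 0 ∧ wt x ≤ 6 ∧ wt x + wt (x ᵥ* genMatrix + shadowRight) ≤ 13) ∪
      (Finset.univ.filter fun x : Fin 41 → ZMod 2 =>
        wt (x ᵥ* genMatrix + shadowRight) ≤ 6 ∧ wt x + wt (x ᵥ* genMatrix + shadowRight) ≤ 13) := by
    ext x
    simp only [Finset.mem_insert, Finset.mem_union, Finset.mem_filter, Finset.mem_univ, true_and]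
    have h4 := shadowWt_mod_four x
    by_cases hx : x = 0
    · subst hx
      simp [shadowWt_zero, wt_shadowRight, (wt_eq_zero_iff (0 : Fin 41 → ZMod 2)).2 rfl]
    · have h9 : ¬ shadowWt x ≤ 9 := fun h => hx (eq_zero_of_shadowWt_le h)
      have hs : shadowWt x = wt x + wt (x ᵥ* genMatrix + shadowRight) := rfl
      simp only [hx, ne_eq, not_false_eq_true, true_and, false_or]
      omega
  have hc := congrArg Finset.card hu
  rw [Finset.card_insert_of_notMem h0, Finset.card_union_of_disjoint hd, hl, hr'] at hc
  omega

lemma shadowWt_one_add (x : Fin 41 → ZMod 2) : shadowWt (1 + x) = 82 - shadowWt x := by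
  rw [shadowWt, shadowWt, add_vecMul, one_vecMul_genMatrix, add_assoc, wt_one_add, wt_one_add]
  have h1 := wt_le x
  have h2 := wt_le (x ᵥ* genMatrix + shadowRight)
  omega

lemma shadowWt_le (x : Fin 41 → ZMod 2) : shadowWt x ≤ 82 :=
  add_le_add (wt_le _) (wt_le _)

lemma card_shadowWt_sub (k : ℕ) (hk : k ≤ 82) :
    (Finset.univ.filter fun x => shadowWt x = 82 - k).card =
      (Finset.univ.filter fun x => shadowWt x = k).card := by
  refine Finset.card_equiv (Equiv.addLeft 1) fun x => ?_
  have := shadowWt_le x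
  simp only [Finset.mem_filter, Finset.mem_univ, true_and, Equiv.coe_addLeft, shadowWt_one_add]
  omega

lemma shadowWt_cases (x : Fin 41 → ZMod 2) :
    shadowWt x = 5 ∨ shadowWt x = 77 ∨ 13 ≤ shadowWt x ∧ shadowWt x ≤ 69 := by
  have h4 := shadowWt_mod_four x
  have h1 := shadowWt_one_add x
  by_cases h9 : shadowWt x ≤ 9
  · rw [eq_zero_of_shadowWt_le h9, shadowWt_zero]
    exact .inl rfl
  · by_cases h73 : 73 ≤ shadowWt x
    · have h0 := eq_zero_of_shadowWt_le (x := 1 + x) (by omega)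
      rw [h0, shadowWt_zero] at h1
      omega
    · omega

/-- The number of codewords of weight `w`. -/
def numWt (w : ℕ) : ℕ := (Finset.univ.filter fun x => wt (encode genMatrix x) = w).card

open Polynomial in
theorem shadow_macWilliams :
    ∑ x, (1 - X : ℤ[X]) ^ shadowWt x * (1 + X) ^ (82 - shadowWt x) =
      (2 ^ 41 : ℤ) • ∑ x, C (signChar (shadowRight ⬝ᵥ (x ᵥ* genMatrix))) *
        X ^ wt (encode genMatrix x) := by
  have h := sum_coset_weights_encode genMatrix mem_code_iff 0 shadowRight
  simp only [zero_add, zero_dotProduct] at h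
  exact h

theorem weigh_shadow (l : List ℤ) (hl : l.length = 19) (p q : ℤ)
    (hpq : ∀ j < 78, j % 4 = 1 → j ≠ 1 → j ≠ 9 → j ≠ 73 →
      (List.zipWith (· * ·) l (krawtchoukList 18 j (82 - j))).sum =
        (if j = 5 then p else 0) + (if j = 77 then p else 0) +
          (if j = 13 then q else 0) + (if j = 69 then q else 0)) :
    2 * p + 1206 * q =
      2 ^ 41 * (l.getD 0 0 - l.getD 14 0 * numWt 14 + l.getD 16 0 * numWt 16 -
        l.getD 18 0 * numWt 18) := by
  have h := congrArg (weigh l) shadow_macWilliams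
  rw [map_sum, map_zsmul, map_sum] at h
  simp only [weigh_krawtchouk l 18 _ _ hl, weigh_C_mul_X_pow, smul_eq_mul] at h
  have hL : ∀ x, (List.zipWith (· * ·) l
      (krawtchoukList 18 (shadowWt x) (82 - shadowWt x))).sum =
        (if shadowWt x = 5 then p else 0) + (if shadowWt x = 77 then p else 0) +
          (if shadowWt x = 13 then q else 0) + (if shadowWt x = 69 then q else 0) := by
    intro x
    have h4 := shadowWt_mod_four x
    have := shadowWt_cases x
    exact hpq _ (by omega) h4 (by omega) (by omega) (by omega)
  have hR : ∀ x, signChar (shadowRight ⬝ᵥ (x ᵥ* genMatrix)) *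
      l.getD (wt (encode genMatrix x)) 0 =
        (if wt (encode genMatrix x) = 0 then l.getD 0 0 else 0) +
        (if wt (encode genMatrix x) = 14 then -l.getD 14 0 else 0) +
        (if wt (encode genMatrix x) = 16 then l.getD 16 0 else 0) +
        (if wt (encode genMatrix x) = 18 then -l.getD 18 0 else 0) := by
    intro x
    have h4 := wt_encode_genMatrix_cast x
    have hs : ∀ z : ZMod 2, signChar z = if 2 * (z.val : ZMod 4) = 0 then 1 else -1 := by decide
    have h2 : ∀ z : ZMod 2, 2 * (2 * (z.val : ZMod 4)) = 0 := by decide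
    have hd : ((2 * wt (encode genMatrix x) : ℕ) : ZMod 4) = 0 := by
      rw [Nat.cast_mul, h4]; exact h2 _
    rw [ZMod.natCast_eq_zero_iff] at hd
    rw [hs, ← h4]
    simp only [ZMod.natCast_eq_zero_iff]
    have hw : wt (encode genMatrix x) = 0 ∨ 14 ≤ wt (encode genMatrix x) := by
      by_cases hx : x = 0
      · left; rw [hx, map_zero, wt_eq_zero_iff]
      · exact .inr (le_wt_encode hx)
    generalize wt (encode genMatrix x) = w at hd hw
    obtain rfl | rfl | rfl | rfl | hw : w = 0 ∨ w = 14 ∨ w = 16 ∨ w = 18 ∨ 19 ≤ w := by omega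
    · norm_num
    · norm_num
    · norm_num
    · norm_num
    · rw [List.getD_eq_default _ _ (by omega)]
      rw [mul_zero, if_neg (by omega), if_neg (by omega), if_neg (by omega), if_neg (by omega)]
      norm_num
  have h0 : (Finset.univ.filter fun x => wt (encode genMatrix x) = 0).card = 1 :=
    card_wt_encode_zero _
  simp only [hL, hR, Finset.sum_add_distrib, ← Finset.sum_filter, Finset.sum_const, h0,
    card_shadowWt_five, card_shadowWt_thirteen, card_shadowWt_sub 5 (by norm_num),
    card_shadowWt_sub 13 (by norm_num), nsmul_eq_mul] at h
  simp only [numWt]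
  push_cast at h
  linarith

lemma numWt_fourteen : numWt 14 = 1804 := by
  have h := weigh_shadow [3280, 0, 80, 0, 585, 0, 45, 0, 74, 0, 10, 0, 5, 0, 1, 0, 0, 0, 0] rfl
    296868139499520 2199023255552 (by decide +kernel)
  simp only [List.getD_cons_zero, List.getD_cons_succ] at h
  omega

lemma numWt_sixteen : numWt 16 = 40024 := by
  have h := weigh_shadow
    [-36244, 0, 14601, 0, -4208, 0, 1474, 0, -267, 0, 77, 0, 2, 0, 0, 0, 1, 0, 0] rfl
    2830142929895424 2199023255552 (by decide +kernel)
  simp only [List.getD_cons_zero, List.getD_cons_succ] at h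
  omega

lemma numWt_eighteen : numWt 18 = 509213 := by
  have h := weigh_shadow
    [514345, 0, -173940, 0, 40560, 0, -11890, 0, 1249, 0, -375, 0, -50, 0, 0, 0, 0, 0, 1] rfl
    22880836974018560 (-28587302322176) (by decide +kernel)
  simp only [List.getD_cons_zero, List.getD_cons_succ] at h
  omega

end Main

/-- There exists a binary self-dual `[82, 41, 14]` code with
`A₁₄ = 3280 + 2α`, `A₁₆ = 36244 - 2α + 128β` and `A₁₈ = 506153 - 26α - 896β`
for `α = -738` and `β = 18` (weight enumerator `W₈₂,₂`). -/
theorem exists_self_dual_82_41_14 :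
    ∃ C : Submodule (ZMod 2) (Fin 82 → ZMod 2),
      (∀ x, x ∈ C ↔ ∀ y ∈ C, ∑ i, x i * y i = 0) ∧
      Module.finrank (ZMod 2) C = 41 ∧
      (∀ x ∈ C, x ≠ 0 → 14 ≤ wt x) ∧
      (∃ x ∈ C, x ≠ 0 ∧ wt x = 14) ∧
      ({x | x ∈ C ∧ wt x = 14}.ncard : ℤ) = 3280 + 2 * (-738) ∧
      ({x | x ∈ C ∧ wt x = 16}.ncard : ℤ) = 36244 - 2 * (-738) + 128 * 18 ∧
      ({x | x ∈ C ∧ wt x = 18}.ncard : ℤ) = 506153 - 26 * (-738) - 896 * 18 := by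
  refine ⟨LinearMap.range (encode genMatrix), mem_code_iff, ?_, ?_, ?_, ?_, ?_, ?_⟩
  · rw [LinearMap.finrank_range_of_inj (encode_injective genMatrix), Module.finrank_fin_fun]
  · rintro _ ⟨x, rfl⟩ hx
    exact le_wt_encode fun h => hx (h ▸ map_zero _)
  · refine exists_mem_range_encode _ (by norm_num) (ne_of_eq_of_ne numWt_fourteen (by norm_num))
  · exact (congrArg Nat.cast ((ncard_range_encode _ 14).trans numWt_fourteen)).trans (by norm_num)
  · exact (congrArg Nat.cast ((ncard_range_encode _ 16).trans numWt_sixteen)).trans (by norm_num)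
  · exact (congrArg Nat.cast ((ncard_range_encode _ 18).trans numWt_eighteen)).trans (by norm_num)
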